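/- There exists a constant B, depending only on n, m, α, β, ρ, with the following property. Let L ∈ ℤ, let a be measurable, supported in ½Q, with |a| ≤ 2^{(n+m)(1−L)} pointwise, and let ℓ ≥ 1 be an integer. Then for every (x,y) ∈ Q_{0ℓ}: |I a(x,y)| ≤ B · ∑_{s ≤ L} 2^{−Ln} · 2^{sα} · (2^{ρs} + 2^{ℓ+L})^{β−m}; in particular, if ℓ ≥ (ρ−1)L then |I a(x,y)| ≤ B · 2^{L(α−n)} · 2^{(ℓ+L)(β−m)}. (No cancellation hypothesis on a is required.) -/

import Mathlib

open MeasureTheory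

/-- The flag kernel `Ω(x,y) = |x|^(α-n) (|x|^ρ + |y|)^(β-m)` on `ℝ^n × ℝ^m`. -/
noncomputable def flagKernel (n m : ℕ) (α β ρ : ℝ)
    (x : EuclideanSpace ℝ (Fin n)) (y : EuclideanSpace ℝ (Fin m)) : ℝ :=
  ‖x‖ ^ (α - (n : ℝ)) * (‖x‖ ^ ρ + ‖y‖) ^ (β - (m : ℝ))

/-- The fractional integral operator `I f(x,y) = ∬ f(u,v) Ω(x-u, y-v) du dv`. -/
noncomputable def flagOp (n m : ℕ) (α β ρ : ℝ)
    (f : EuclideanSpace ℝ (Fin n) × EuclideanSpace ℝ (Fin m) → ℝ)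
    (z : EuclideanSpace ℝ (Fin n) × EuclideanSpace ℝ (Fin m)) : ℝ :=
  ∫ w : EuclideanSpace ℝ (Fin n) × EuclideanSpace ℝ (Fin m),
    f w * flagKernel n m α β ρ (z.1 - w.1) (z.2 - w.2)

/-- The `ℓ^∞` (sup) norm `‖x‖_∞` of a point of Euclidean space. -/
noncomputable def supAbs {n : ℕ} (x : EuclideanSpace ℝ (Fin n)) : ℝ :=
  ‖(WithLp.equiv 2 (Fin n → ℝ)) x‖

lemma supAbs_le_norm {n : ℕ} (x : EuclideanSpace ℝ (Fin n)) : supAbs x ≤ ‖x‖ :=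
  (pi_norm_le_iff_of_nonneg (norm_nonneg x)).2 fun i => PiLp.norm_apply_le x i

lemma norm_le_mul_supAbs {n : ℕ} (x : EuclideanSpace ℝ (Fin n)) : ‖x‖ ≤ n * supAbs x := by
  have h0 : 0 ≤ supAbs x := norm_nonneg _
  rw [EuclideanSpace.norm_eq]
  refine Real.sqrt_le_iff.2 ⟨by positivity, ?_⟩
  have h1 : ∑ i, ‖x i‖ ^ 2 ≤ ∑ _i : Fin n, supAbs x ^ 2 := by
    gcongr with i
    exact norm_le_pi_norm ((WithLp.equiv 2 (Fin n → ℝ)) x) i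
  have h2 : (n : ℝ) ≤ (n : ℝ) ^ 2 := by exact_mod_cast Nat.le_self_pow two_ne_zero n
  calc ∑ i, ‖x i‖ ^ 2 ≤ n * supAbs x ^ 2 := by simpa using h1
    _ ≤ n ^ 2 * supAbs x ^ 2 := by gcongr
    _ = (n * supAbs x) ^ 2 := by ring

lemma supAbs_sub_le {n : ℕ} (x y : EuclideanSpace ℝ (Fin n)) :
    supAbs (x - y) ≤ supAbs x + supAbs y :=
  norm_sub_le ((WithLp.equiv 2 (Fin n → ℝ)) x) ((WithLp.equiv 2 (Fin n → ℝ)) y)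

lemma supAbs_sub_supAbs_le {n : ℕ} (x y : EuclideanSpace ℝ (Fin n)) :
    supAbs x - supAbs y ≤ supAbs (x - y) :=
  norm_sub_norm_le ((WithLp.equiv 2 (Fin n → ℝ)) x) ((WithLp.equiv 2 (Fin n → ℝ)) y)

lemma flagKernel_nonneg (n m : ℕ) (α β ρ : ℝ)
    (x : EuclideanSpace ℝ (Fin n)) (y : EuclideanSpace ℝ (Fin m)) :
    0 ≤ flagKernel n m α β ρ x y := by
  unfold flagKernel
  positivity

lemma flagKernel_zero_left {n : ℕ} (m : ℕ) {α : ℝ} (β ρ : ℝ) (hαn : α < n)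
    (y : EuclideanSpace ℝ (Fin m)) : flagKernel n m α β ρ 0 y = 0 := by
  simp [flagKernel, Real.zero_rpow (sub_neg.2 hαn).ne]

lemma flagKernel_le {n m : ℕ} {α β ρ r d : ℝ} (hαn : α ≤ n) (hβm : β ≤ m) (hρ : 0 ≤ ρ)
    (hr : 0 < r) (hd : 0 < d) {x : EuclideanSpace ℝ (Fin n)} {y : EuclideanSpace ℝ (Fin m)}
    (hx : r ≤ ‖x‖) (hy : d ≤ 4 * ‖y‖) :
    flagKernel n m α β ρ x y ≤
      r ^ (α - n) * ((4 : ℝ) ^ (m - β) * (r ^ ρ + d) ^ (β - m)) := by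
  have hrρ : 0 < r ^ ρ := Real.rpow_pos_of_pos hr ρ
  have hle : (r ^ ρ + d) / 4 ≤ ‖x‖ ^ ρ + ‖y‖ := by
    have := Real.rpow_le_rpow hr.le hx hρ
    linarith
  have h4 : ((r ^ ρ + d) / 4) ^ (β - m) = (4 : ℝ) ^ (m - β) * (r ^ ρ + d) ^ (β - m) := by
    rw [Real.div_rpow (by positivity) (by norm_num), div_eq_mul_inv, mul_comm,
      ← Real.rpow_neg (by norm_num), neg_sub]
  rw [flagKernel, ← h4]
  have h1 := Real.rpow_le_rpow_of_nonpos hr hx (sub_nonpos.2 hαn)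
  have h2 := Real.rpow_le_rpow_of_nonpos (by positivity) hle (sub_nonpos.2 hβm)
  gcongr

/-- The dyadic sum `∑_{s ≤ L} 2^{sα} (2^{ρs} + d)^γ` converges and is dominated by a geometric
series. -/
lemma summable_dyadic_and_tsum_le {α γ ρ L d : ℝ} (hα : 0 < α) (hγ : γ ≤ 0) (hd : 0 < d) :
    Summable (fun j : ℕ => (2 : ℝ) ^ ((L - j) * α) * ((2 : ℝ) ^ (ρ * (L - j)) + d) ^ γ) ∧
      ∑' j : ℕ, (2 : ℝ) ^ ((L - j) * α) * ((2 : ℝ) ^ (ρ * (L - j)) + d) ^ γ ≤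
        (1 - (2 : ℝ) ^ (-α))⁻¹ * ((2 : ℝ) ^ (L * α) * d ^ γ) := by
  have hq0 : (0 : ℝ) ≤ 2 ^ (-α) := by positivity
  have hq1 : (2 : ℝ) ^ (-α) < 1 := Real.rpow_lt_one_of_one_lt_of_neg one_lt_two (neg_lt_zero.2 hα)
  have hgeom := (hasSum_geometric_of_lt_one hq0 hq1).mul_right ((2 : ℝ) ^ (L * α) * d ^ γ)
  have hle : ∀ j : ℕ, (2 : ℝ) ^ ((L - j) * α) * ((2 : ℝ) ^ (ρ * (L - j)) + d) ^ γ ≤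
      ((2 : ℝ) ^ (-α)) ^ j * ((2 : ℝ) ^ (L * α) * d ^ γ) := by
    intro j
    have h1 : (2 : ℝ) ^ ((L - j) * α) = ((2 : ℝ) ^ (-α)) ^ j * (2 : ℝ) ^ (L * α) := by
      rw [← Real.rpow_mul_natCast (by norm_num), ← Real.rpow_add (by norm_num)]
      ring_nf
    have h2 : ((2 : ℝ) ^ (ρ * (L - j)) + d) ^ γ ≤ d ^ γ :=
      Real.rpow_le_rpow_of_nonpos hd (le_add_of_nonneg_left (by positivity)) hγ
    rw [h1, mul_assoc]
    gcongr
  have hs := Summable.of_nonneg_of_le (fun j => by positivity) hle hgeom.summable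
  exact ⟨hs, (hs.tsum_le_tsum hle hgeom.summable).trans_eq hgeom.tsum_eq⟩

lemma abs_integral_le_tsum_of_forall_exists_mem {X : Type*} [MeasurableSpace X] {μ : Measure X}
    {f : X → ℝ} {s : ℕ → Set X} {k b : ℕ → ℝ} (hs : ∀ j, MeasurableSet (s j))
    (hf : ∀ x, f x ≠ 0 → ∃ j, x ∈ s j ∧ |f x| ≤ k j) (hb : Summable b) (hb0 : ∀ j, 0 ≤ b j)
    (hsb : ∀ j, ENNReal.ofReal (k j) * μ (s j) ≤ ENNReal.ofReal (b j)) :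
    |∫ x, f x ∂μ| ≤ ∑' j, b j := by
  have hpt : ∀ x, ENNReal.ofReal ‖f x‖ ≤
      ∑' j, (s j).indicator (fun _ => ENNReal.ofReal (k j)) x := by
    intro x
    rcases eq_or_ne (f x) 0 with h0 | h0
    · simp [h0]
    · obtain ⟨j, hxj, hj⟩ := hf x h0
      refine le_trans ?_ (ENNReal.le_tsum j)
      rw [Set.indicator_of_mem hxj]
      exact ENNReal.ofReal_le_ofReal hj
  have hint : ∫⁻ x, ENNReal.ofReal ‖f x‖ ∂μ ≤ ENNReal.ofReal (∑' j, b j) := by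
    calc ∫⁻ x, ENNReal.ofReal ‖f x‖ ∂μ
        ≤ ∫⁻ x, ∑' j, (s j).indicator (fun _ => ENNReal.ofReal (k j)) x ∂μ := lintegral_mono hpt
      _ = ∑' j, ENNReal.ofReal (k j) * μ (s j) := by
        rw [lintegral_tsum fun j => (measurable_const.indicator (hs j)).aemeasurable]
        exact tsum_congr fun j => lintegral_indicator_const (hs j) _
      _ ≤ ∑' j, ENNReal.ofReal (b j) := ENNReal.tsum_le_tsum hsb
      _ = ENNReal.ofReal (∑' j, b j) := (ENNReal.ofReal_tsum_of_nonneg hb0 hb).symm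
  rw [← Real.norm_eq_abs]
  exact (norm_integral_le_lintegral_norm f).trans
    (ENNReal.toReal_le_of_le_ofReal (tsum_nonneg hb0) hint)

lemma volume_closedBall_eq_ofReal {n : ℕ} (x : EuclideanSpace ℝ (Fin n)) {r : ℝ} (hr : 0 ≤ r) :
    volume (Metric.closedBall x r) =
      ENNReal.ofReal (r ^ n * volume.real (Metric.ball (0 : EuclideanSpace ℝ (Fin n)) 1)) := by
  rw [Measure.addHaar_closedBall _ x hr, finrank_euclideanSpace_fin,
    ENNReal.ofReal_mul (by positivity), measureReal_def,
    ENNReal.ofReal_toReal Metric.isBounded_ball.measure_lt_top.ne]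

lemma abs_flagOp_le_tsum {n m : ℕ} (hn : 0 < n) {α β ρ : ℝ}
    (hα : 0 < α) (hαn : α < n) (hβm : β < m) (hρ : 0 ≤ ρ) {L : ℤ}
    {a : EuclideanSpace ℝ (Fin n) × EuclideanSpace ℝ (Fin m) → ℝ}
    (hsupp : ∀ w, a w ≠ 0 → max (supAbs w.1) (supAbs w.2) ≤ (2 : ℝ) ^ (L - 2))
    (hbound : ∀ w, |a w| ≤ (2 : ℝ) ^ (((n : ℤ) + m) * (1 - L)))
    {l : ℕ} (hl : 1 ≤ l) {w : EuclideanSpace ℝ (Fin n) × EuclideanSpace ℝ (Fin m)}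
    (hw1 : supAbs w.1 < (2 : ℝ) ^ L) (hw2 : (2 : ℝ) ^ (L + (l : ℤ) - 1) ≤ supAbs w.2) :
    |flagOp n m α β ρ a w| ≤
      ((2 : ℝ) ^ (n + m) * (2 * n) ^ n * m ^ m * (4 : ℝ) ^ (m - β) *
        volume.real (Metric.ball (0 : EuclideanSpace ℝ (Fin n)) 1) *
        volume.real (Metric.ball (0 : EuclideanSpace ℝ (Fin m)) 1)) *
      ∑' j : ℕ, (2 : ℝ) ^ (-(L : ℝ) * n) * ((2 : ℝ) ^ (((L : ℝ) - j) * α) *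
        ((2 : ℝ) ^ (ρ * ((L : ℝ) - j)) + (2 : ℝ) ^ ((l : ℝ) + (L : ℝ))) ^ (β - (m : ℝ))) := by
  set C : ℝ := (2 : ℝ) ^ (n + m) * (2 * n) ^ n * m ^ m * (4 : ℝ) ^ (m - β) *
        volume.real (Metric.ball (0 : EuclideanSpace ℝ (Fin n)) 1) *
        volume.real (Metric.ball (0 : EuclideanSpace ℝ (Fin m)) 1) with hC
  have hn1 : (1 : ℝ) ≤ n := by exact_mod_cast hn
  set d : ℝ := (2 : ℝ) ^ ((l : ℝ) + (L : ℝ)) with hd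
  have hd0 : 0 < d := by positivity
  have hLpos : (0 : ℝ) < 2 ^ L := by positivity
  have hL2 : (2 : ℝ) ^ (L - 2) = 2 ^ L / 4 := by
    rw [zpow_sub₀ two_ne_zero]; norm_num
  have hdL : d = 2 ^ L * 2 ^ l := by
    rw [hd, Real.rpow_add two_pos, Real.rpow_natCast, Real.rpow_intCast, mul_comm]
  have hLd : (2 : ℝ) ^ (L + (l : ℤ) - 1) = d / 2 := by
    rw [zpow_sub₀ two_ne_zero, zpow_add₀ two_ne_zero, hdL]; norm_num
  have hd2 : 2 * 2 ^ L ≤ d := by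
    have : (2 : ℝ) ^ 1 ≤ 2 ^ l := pow_le_pow_right₀ one_le_two hl
    rw [hdL]; nlinarith
  have hr : ∀ j : ℕ, (2 : ℝ) ^ ((L : ℝ) - j) = 2 ^ L * (1 / 2) ^ j := fun j => by
    rw [Real.rpow_sub two_pos, Real.rpow_natCast, Real.rpow_intCast]; simp [div_eq_mul_inv]
  have hsum := (summable_dyadic_and_tsum_le (α := α) (γ := β - m) (ρ := ρ) (L := L) hα
    (sub_nonpos.2 hβm.le) hd0).1
  rw [← tsum_mul_left]
  unfold flagOp
  refine abs_integral_le_tsum_of_forall_exists_mem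
    (s := fun j => Metric.closedBall w.1 (2 * n * (2 : ℝ) ^ ((L : ℝ) - j)) ×ˢ
      Metric.closedBall 0 (m * 2 ^ L))
    (k := fun j => (2 : ℝ) ^ (((n : ℤ) + m) * (1 - L)) * (((2 : ℝ) ^ ((L : ℝ) - j)) ^ (α - n) *
      ((4 : ℝ) ^ (m - β) * (((2 : ℝ) ^ ((L : ℝ) - j)) ^ ρ + d) ^ (β - m))))
    (fun j => measurableSet_closedBall.prod measurableSet_closedBall)
    ?_ ((hsum.mul_left _).mul_left _) (fun j => by positivity) ?_
  · intro v hv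
    have hav : a v ≠ 0 := left_ne_zero_of_mul hv
    have hx0 : w.1 - v.1 ≠ 0 := fun h => by
      rw [h, flagKernel_zero_left m β ρ hαn, mul_zero] at hv
      exact hv rfl
    obtain ⟨hv1, hv2⟩ := max_le_iff.1 (hsupp v hav)
    rw [hL2] at hv1 hv2
    rw [hLd] at hw2
    have hxn : ‖w.1 - v.1‖ ≤ 2 * n * 2 ^ L := by
      have h1 := norm_le_mul_supAbs (w.1 - v.1)
      have h2 : supAbs (w.1 - v.1) ≤ 2 * 2 ^ L := by
        linarith [supAbs_sub_le w.1 v.1]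
      nlinarith
    have hyn : d ≤ 4 * ‖w.2 - v.2‖ := by
      linarith [supAbs_sub_supAbs_le w.2 v.2, supAbs_le_norm (w.2 - v.2)]
    have hR : (0 : ℝ) < 2 * n * 2 ^ L := by positivity
    obtain ⟨j, hj1, hj2⟩ := exists_nat_pow_near_of_lt_one
      (div_pos (norm_pos_iff.2 hx0) hR) ((div_le_one hR).2 hxn)
      (y := (1 / 2 : ℝ)) (by norm_num) (by norm_num)
    rw [lt_div_iff₀ hR, pow_succ] at hj1
    rw [div_le_iff₀ hR] at hj2
    have hj : (0 : ℝ) < 2 ^ L * (1 / 2) ^ j := by positivity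
    refine ⟨j, ⟨?_, ?_⟩, ?_⟩
    · rw [Metric.mem_closedBall, dist_comm, dist_eq_norm, hr]
      linarith
    · rw [mem_closedBall_zero_iff]
      refine (norm_le_mul_supAbs v.2).trans ?_
      gcongr
      linarith
    · rw [abs_mul, abs_of_nonneg (flagKernel_nonneg _ _ _ _ _ _ _)]
      refine mul_le_mul (hbound v) (flagKernel_le hαn.le hβm.le hρ (by positivity) hd0 ?_ hyn)
        (flagKernel_nonneg _ _ _ _ _ _ _) (by positivity)
      rw [hr]
      nlinarith
  · intro j
    rw [Measure.volume_eq_prod, Measure.prod_prod,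
      volume_closedBall_eq_ofReal _ (by positivity), volume_closedBall_eq_ofReal _ (by positivity),
      ← ENNReal.ofReal_mul (by positivity), ← ENNReal.ofReal_mul (by positivity)]
    refine ENNReal.ofReal_le_ofReal (le_of_eq ?_)
    have h1 : (2 : ℝ) ^ (((n : ℤ) + m) * (1 - L)) * (2 ^ L) ^ m =
        2 ^ (n + m) * 2 ^ (-(L : ℝ) * n) := by
      rw [← Real.rpow_intCast, ← Real.rpow_intCast, ← Real.rpow_natCast, ← Real.rpow_natCast,
        ← Real.rpow_mul two_pos.le, ← Real.rpow_add two_pos, ← Real.rpow_add two_pos]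
      congr 1
      push_cast
      ring
    have h2 : ((2 : ℝ) ^ ((L : ℝ) - j)) ^ (α - n) * ((2 : ℝ) ^ ((L : ℝ) - j)) ^ n =
        2 ^ (((L : ℝ) - j) * α) := by
      rw [← Real.rpow_natCast, ← Real.rpow_add (by positivity), ← Real.rpow_mul two_pos.le,
        sub_add_cancel]
    have h3 : ((2 : ℝ) ^ ((L : ℝ) - j)) ^ ρ = 2 ^ (ρ * ((L : ℝ) - j)) := by
      rw [← Real.rpow_mul two_pos.le, mul_comm]
    rw [h3, hC, ← h2, mul_pow _ _ n, mul_pow _ _ m]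
    linear_combination (((2 : ℝ) ^ ((L : ℝ) - j)) ^ (α - n) * ((2 : ℝ) ^ ((L : ℝ) - j)) ^ n *
      (4 : ℝ) ^ (m - β) * (2 ^ (ρ * ((L : ℝ) - j)) + d) ^ (β - m) * (2 * n) ^ n * m ^ m *
      volume.real (Metric.ball (0 : EuclideanSpace ℝ (Fin n)) 1) *
      volume.real (Metric.ball (0 : EuclideanSpace ℝ (Fin m)) 1)) * h1

/-- Pointwise estimate in Case 4: on the shell `Q_{0ℓ}` (`ℓ ≥ 1`),
`|I a| ≤ B ∑_{s ≤ L} 2^{-Ln} 2^{sα} (2^{ρs} + 2^{ℓ+L})^{β-m}` (sum over integers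
`s = L - j`, `j ∈ ℕ`), and in particular, if `ℓ ≥ (ρ-1)L` then
`|I a| ≤ B 2^{L(α-n)} 2^{(ℓ+L)(β-m)}`; no cancellation on `a` is needed. -/
theorem flagOp_atom_pointwise_case4 (n m : ℕ) (hn : 0 < n) (hm : 0 < m) (α β ρ : ℝ)
    (hα : 0 < α) (hαn : α < n) (hβ : 0 < β) (hβm : β < m) (hρ : 1 ≤ ρ) :
    ∃ B : ℝ, 0 < B ∧
      ∀ (L : ℤ) (a : EuclideanSpace ℝ (Fin n) × EuclideanSpace ℝ (Fin m) → ℝ),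
        Measurable a →
        (∀ w, a w ≠ 0 → max (supAbs w.1) (supAbs w.2) ≤ (2 : ℝ) ^ (L - 2)) →
        (∀ w, |a w| ≤ (2 : ℝ) ^ (((n : ℤ) + m) * (1 - L))) →
        ∀ l : ℕ, 1 ≤ l →
        ∀ w : EuclideanSpace ℝ (Fin n) × EuclideanSpace ℝ (Fin m),
          supAbs w.1 < (2 : ℝ) ^ L →
          ((2 : ℝ) ^ (L + (l : ℤ) - 1) ≤ supAbs w.2 ∧ supAbs w.2 < (2 : ℝ) ^ (L + (l : ℤ))) →
          (|flagOp n m α β ρ a w| ≤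
            B * ∑' (j : ℕ),
              (2 : ℝ) ^ (-(L : ℝ) * n) * (2 : ℝ) ^ (((L : ℝ) - j) * α) *
                ((2 : ℝ) ^ (ρ * ((L : ℝ) - j)) + (2 : ℝ) ^ ((l : ℝ) + (L : ℝ))) ^
                  (β - (m : ℝ))) ∧
          ((ρ - 1) * (L : ℝ) ≤ (l : ℝ) →
            |flagOp n m α β ρ a w| ≤
              B * (2 : ℝ) ^ ((L : ℝ) * (α - n)) *
                (2 : ℝ) ^ (((l : ℝ) + (L : ℝ)) * (β - m))) := by
  set C : ℝ := (2 : ℝ) ^ (n + m) * (2 * n) ^ n * m ^ m * (4 : ℝ) ^ (m - β) *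
        volume.real (Metric.ball (0 : EuclideanSpace ℝ (Fin n)) 1) *
        volume.real (Metric.ball (0 : EuclideanSpace ℝ (Fin m)) 1) with hC
  have hV : ∀ k : ℕ, 0 < volume.real (Metric.ball (0 : EuclideanSpace ℝ (Fin k)) 1) := fun k =>
    ENNReal.toReal_pos (Metric.measure_ball_pos _ _ one_pos).ne'
      Metric.isBounded_ball.measure_lt_top.ne
  have hC0 : 0 < C := by
    have := hV n
    have := hV m
    positivity
  have hq1 : (2 : ℝ) ^ (-α) < 1 := Real.rpow_lt_one_of_one_lt_of_neg one_lt_two (neg_lt_zero.2 hα)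
  have hq : 0 < 1 - (2 : ℝ) ^ (-α) := sub_pos.2 hq1
  have hG : 1 ≤ (1 - (2 : ℝ) ^ (-α))⁻¹ :=
    (one_le_inv₀ hq).2 (sub_le_self _ (by positivity))
  refine ⟨C * (1 - (2 : ℝ) ^ (-α))⁻¹, by positivity, ?_⟩
  intro L a _ hsupp hbound l hl w hw1 hw2
  have key := abs_flagOp_le_tsum hn hα hαn hβm (zero_le_one.trans hρ) hsupp hbound hl hw1 hw2.1
  rw [← hC] at key
  simp only [mul_assoc ((2 : ℝ) ^ (-(L : ℝ) * n))]
  refine ⟨key.trans ?_, fun _ => key.trans ?_⟩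
  · gcongr
    exact le_mul_of_one_le_right hC0.le hG
  · have hle := (summable_dyadic_and_tsum_le (γ := β - m) (ρ := ρ) (L := L)
      (d := (2 : ℝ) ^ ((l : ℝ) + (L : ℝ))) hα (sub_nonpos.2 hβm.le) (by positivity)).2
    rw [tsum_mul_left]
    calc _ ≤ C * ((2 : ℝ) ^ (-(L : ℝ) * n) * ((1 - (2 : ℝ) ^ (-α))⁻¹ * ((2 : ℝ) ^ (L * α) *
          ((2 : ℝ) ^ ((l : ℝ) + (L : ℝ))) ^ (β - (m : ℝ))))) := by gcongr
      _ = _ := by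
        have h1 : (2 : ℝ) ^ ((L : ℝ) * (α - n)) = 2 ^ (-(L : ℝ) * n) * 2 ^ (L * α) := by
          rw [← Real.rpow_add two_pos]
          ring_nf
        rw [h1, ← Real.rpow_mul two_pos.le]
        ring
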